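/- arXiv:2604.22712 — 5 statements merged into one kernel-verified Lean document; each statement's English description precedes it below -/
import Mathlib

section
/- Let f : [0,∞) × ℝ^d → ℝ^d and σ : [0,∞) × ℝ^d → ℝ be smooth, and let p : [0,∞) × ℝ^d → (0,∞) be a smooth family of probability densities satisfying the Fokker–Planck equation ∂_τ p_τ(y) = −div_y(f_τ(y) p_τ(y)) + Δ_y(σ_τ(y)² p_τ(y)) for all τ and y. Then p also satisfies the transport (continuity) equation ∂_τ p_τ(y) = −div_y(u_τ(y) p_τ(y)) with velocity field u_τ := f_τ − σ_τ² ∇ log p_τ − ∇(σ_τ²). -/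
open MeasureTheory

/-- Partial derivative in the `i`-th coordinate direction of a scalar function on `ℝ^d`. -/
noncomputable def pderiv' (d : ℕ) (i : Fin d) (φ : (Fin d → ℝ) → ℝ) (y : Fin d → ℝ) : ℝ :=
  fderiv ℝ φ y (Pi.single i 1)

/-- Spatial divergence of a vector field on `ℝ^d`. -/
noncomputable def vdiv (d : ℕ) (F : (Fin d → ℝ) → (Fin d → ℝ)) (y : Fin d → ℝ) : ℝ :=
  ∑ i, pderiv' d i (fun y => F y i) y

/-- Spatial Laplacian of a scalar function on `ℝ^d`. -/
noncomputable def vlap (d : ℕ) (φ : (Fin d → ℝ) → ℝ) (y : Fin d → ℝ) : ℝ :=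
  ∑ i, pderiv' d i (fun y => pderiv' d i φ y) y

/-- The Leibniz rule for a coordinate partial derivative. -/
theorem pderiv'_mul (d : ℕ) (i : Fin d) {φ ψ : (Fin d → ℝ) → ℝ} {y : Fin d → ℝ}
    (hφ : DifferentiableAt ℝ φ y) (hψ : DifferentiableAt ℝ ψ y) :
    pderiv' d i (fun y => φ y * ψ y) y = φ y * pderiv' d i ψ y + ψ y * pderiv' d i φ y := by
  simp [pderiv', fderiv_fun_mul hφ hψ]

theorem pderiv'_sub (d : ℕ) (i : Fin d) {φ ψ : (Fin d → ℝ) → ℝ} {y : Fin d → ℝ}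
    (hφ : DifferentiableAt ℝ φ y) (hψ : DifferentiableAt ℝ ψ y) :
    pderiv' d i (fun y => φ y - ψ y) y = pderiv' d i φ y - pderiv' d i ψ y := by
  simp [pderiv', fderiv_fun_sub hφ hψ]

theorem ContDiff.differentiable_pderiv' (d : ℕ) (i : Fin d) {φ : (Fin d → ℝ) → ℝ}
    (hφ : ContDiff ℝ 2 φ) : Differentiable ℝ (pderiv' d i φ) :=
  ((hφ.fderiv_right (m := 1) (by norm_num)).clm_apply contDiff_const).differentiable
    one_ne_zero

/-- The divergence of the flux `F q` corrected by the score of `q` and the gradient of `s` is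
`div (F q) - Δ (s q)`. -/
theorem vdiv_score_flux (d : ℕ) {F : (Fin d → ℝ) → (Fin d → ℝ)} {s q : (Fin d → ℝ) → ℝ}
    (hF : Differentiable ℝ F) (hs : ContDiff ℝ 2 s) (hq : ContDiff ℝ 2 q)
    (hne : ∀ y, q y ≠ 0) (y : Fin d → ℝ) :
    vdiv d (fun y i => (F y i - s y * (pderiv' d i q y / q y) - pderiv' d i s y) * q y) y
      = vdiv d (fun y i => F y i * q y) y - vlap d (fun y => s y * q y) y := by
  have hs1 : Differentiable ℝ s := hs.differentiable two_ne_zero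
  have hq1 : Differentiable ℝ q := hq.differentiable two_ne_zero
  simp only [vdiv, vlap, ← Finset.sum_sub_distrib]
  refine Finset.sum_congr rfl fun i _ => ?_
  have hFi : Differentiable ℝ (fun y => F y i) := differentiable_pi.1 hF i
  rw [← pderiv'_sub d i ((hFi y).fun_mul (hq1 y))
    ((hs.mul hq).differentiable_pderiv' d i y)]
  congr 1
  funext z
  rw [pderiv'_mul d i (hs1 z) (hq1 z)]
  have := hne z
  field_simp
  ring

/-- A jointly smooth family on `[0,∞) × E` is smooth in space at every time `τ ≥ 0`. -/
theorem ContDiffOn.contDiff_slice {E G : Type*} [NormedAddCommGroup E] [NormedSpace ℝ E]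
    [NormedAddCommGroup G] [NormedSpace ℝ G] {n : WithTop ℕ∞} {g : ℝ → E → G}
    (hg : ContDiffOn ℝ n (fun q : ℝ × E => g q.1 q.2) (Set.Ici 0 ×ˢ Set.univ))
    {τ : ℝ} (hτ : 0 ≤ τ) : ContDiff ℝ n (g τ) := by
  rw [← contDiffOn_univ]
  exact hg.comp (contDiff_prodMk_right τ).contDiffOn fun y _ => ⟨hτ, Set.mem_univ y⟩

/-- If a smooth family of probability densities `p` satisfies the
Fokker–Planck equation `∂_τ p = −div(f p) + Δ(σ² p)` on `[0,∞) × ℝ^d`, then it also satisfies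
the transport (continuity) equation `∂_τ p = −div(u p)` with velocity field
`u_τ = f_τ − σ_τ² ∇log p_τ − ∇(σ_τ²)`, where `∇ log p := (∇p)/p`. -/
theorem fokkerPlanck_to_transport (d : ℕ)
    (f : ℝ → (Fin d → ℝ) → (Fin d → ℝ))
    (σ : ℝ → (Fin d → ℝ) → ℝ)
    (p : ℝ → (Fin d → ℝ) → ℝ)
    (hf : ContDiffOn ℝ (⊤ : ℕ∞) (fun q : ℝ × (Fin d → ℝ) => f q.1 q.2)
      (Set.Ici 0 ×ˢ Set.univ))
    (hσ : ContDiffOn ℝ (⊤ : ℕ∞) (fun q : ℝ × (Fin d → ℝ) => σ q.1 q.2)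
      (Set.Ici 0 ×ˢ Set.univ))
    (hp : ContDiffOn ℝ (⊤ : ℕ∞) (fun q : ℝ × (Fin d → ℝ) => p q.1 q.2)
      (Set.Ici 0 ×ˢ Set.univ))
    (hpos : ∀ τ, 0 ≤ τ → ∀ y, 0 < p τ y)
    (hprob : ∀ τ, 0 ≤ τ → Integrable (p τ) ∧ ∫ y, p τ y = 1)
    (hFP : ∀ τ, 0 ≤ τ → ∀ y,
      deriv (fun s => p s y) τ
        = - vdiv d (fun y i => f τ y i * p τ y) y
          + vlap d (fun y => (σ τ y) ^ 2 * p τ y) y) :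
    ∀ τ, 0 ≤ τ → ∀ y,
      deriv (fun s => p s y) τ
        = - vdiv d (fun y i =>
            (f τ y i - (σ τ y) ^ 2 * (pderiv' d i (p τ) y / p τ y)
              - pderiv' d i (fun y => (σ τ y) ^ 2) y) * p τ y) y := by
  intro τ hτ y
  have two_le : (2 : WithTop ℕ∞) ≤ ((⊤ : ℕ∞) : WithTop ℕ∞) :=
    WithTop.coe_le_coe.2 (le_top : (2 : ℕ∞) ≤ ⊤)
  rw [hFP τ hτ y, vdiv_score_flux d ((hf.contDiff_slice hτ).differentiable (by simp))
    (((hσ.contDiff_slice hτ).of_le two_le).pow 2) ((hp.contDiff_slice hτ).of_le two_le)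
    (fun z => (hpos τ hτ z).ne') y]
  ring
end

section
/- (KL bound for score-based generative models.) Let T > 0 and let (p_τ)_{0≤τ≤T} be smooth positive probability densities on ℝ^d. Let f_τ, ŝ_τ : ℝ^d → ℝ^d and σ_τ, b_τ : ℝ^d → (0,∞) be smooth, and suppose: (i) the reversed family p̄_τ := p_{T−τ} satisfies the transport equation ∂_τ p̄_τ = −div(u_τ p̄_τ) with u_τ := −f_{T−τ} + σ_{T−τ}² ∇ log p_{T−τ} + ∇(σ_{T−τ}²); (ii) a second family of smooth positive probability densities (p̂_τ)_{0≤τ≤T} with p̂_0 = p_∞ satisfies ∂_τ p̂_τ = −div(û_τ p̂_τ) with û_τ := −f_{T−τ} + σ_{T−τ}² ŝ_{T−τ} − b_τ²(∇ log p̂_τ − ŝ_{T−τ}) + ∇(σ_{T−τ}²); and (iii) sufficient integrability and decay hold so that the integrated KL identity along transport equations is valid. Then KL(p_0 | p̂_T) ≤ KL(p_T | p_∞) + ∫_0^T ∫_{ℝ^d} ((σ_{T−τ}(y)² + b_τ(y)²)² / (4 b_τ(y)²)) ‖∇ log p_{T−τ}(y) − ŝ_{T−τ}(y)‖² p_{T−τ}(y)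 dy dτ. -/
open MeasureTheory
open scoped RealInnerProductSpace

/-- Euclidean space `ℝ^d`. -/
abbrev Euc (d : ℕ) := EuclideanSpace ℝ (Fin d)

/-- Score of a positive density: `∇ log p := (∇p)/p`. -/
noncomputable def score {d : ℕ} (p : Euc d → ℝ) (x : Euc d) : Euc d :=
  (p x)⁻¹ • gradient p x

/-- Divergence of a vector field on `ℝ^d`. -/
noncomputable def ediv {d : ℕ} (F : Euc d → Euc d) (x : Euc d) : ℝ :=
  ∑ i, ⟪fderiv ℝ F x (EuclideanSpace.single i 1), EuclideanSpace.single i 1⟫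

/-- Velocity field of the reversed true dynamics:
`u_τ = −f_{T−τ} + σ_{T−τ}² ∇log p_{T−τ} + ∇(σ_{T−τ}²)`. -/
noncomputable def uRev {d : ℕ} (f : ℝ → Euc d → Euc d) (σ : ℝ → Euc d → ℝ)
    (p : ℝ → Euc d → ℝ) (T τ : ℝ) (y : Euc d) : Euc d :=
  - f (T - τ) y + (σ (T - τ) y) ^ 2 • score (p (T - τ)) y
    + gradient (fun y => (σ (T - τ) y) ^ 2) y

/-- Velocity field of the learned generative dynamics:
`û_τ = −f_{T−τ} + σ_{T−τ}² ŝ_{T−τ} − b_τ²(∇log p̂_τ − ŝ_{T−τ}) + ∇(σ_{T−τ}²)`. -/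
noncomputable def uHat {d : ℕ} (f : ℝ → Euc d → Euc d) (σ b : ℝ → Euc d → ℝ)
    (shat : ℝ → Euc d → Euc d) (phat : ℝ → Euc d → ℝ) (T τ : ℝ) (y : Euc d) : Euc d :=
  - f (T - τ) y + (σ (T - τ) y) ^ 2 • shat (T - τ) y
    - (b τ y) ^ 2 • (score (phat τ) y - shat (T - τ) y)
    + gradient (fun y => (σ (T - τ) y) ^ 2) y

/-- Completing the square: for fixed `A`, the expression `⟪s A + t B, A - B⟫` with `t > 0` is at
most `((s + t)² / (4 t)) ‖A‖²`, whatever `B` is. -/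
theorem inner_smul_add_smul_sub_le {E : Type*} [NormedAddCommGroup E] [InnerProductSpace ℝ E]
    (A B : E) (s : ℝ) {t : ℝ} (ht : 0 < t) :
    ⟪s • A + t • B, A - B⟫ ≤ (s + t) ^ 2 / (4 * t) * ‖A‖ ^ 2 := by
  have h : 0 ≤ ⟪(2 * t) • B - (t - s) • A, (2 * t) • B - (t - s) • A⟫ := real_inner_self_nonneg
  rw [← real_inner_self_eq_norm_sq, div_mul_eq_mul_div, le_div_iff₀ (by positivity)]
  simp only [inner_sub_left, inner_sub_right, inner_add_left, real_inner_smul_left,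
    real_inner_smul_right, real_inner_comm A B] at h ⊢
  linarith

theorem uRev_sub_uHat {d : ℕ} (f : ℝ → Euc d → Euc d) (σ b : ℝ → Euc d → ℝ)
    (shat : ℝ → Euc d → Euc d) (p phat : ℝ → Euc d → ℝ) (T τ : ℝ) (y : Euc d) :
    uRev f σ p T τ y - uHat f σ b shat phat T τ y
      = (σ (T - τ) y) ^ 2 • (score (p (T - τ)) y - shat (T - τ) y)
        + (b τ y) ^ 2 • (score (phat τ) y - shat (T - τ) y) := by
  simp only [uRev, uHat]
  module

/-- **KL bound for score-based generative models.**
Let `(p_τ)_{0≤τ≤T}` be smooth positive probability densities whose time reversal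
`p̄_τ = p_{T−τ}` satisfies the transport equation with velocity field `uRev`, and let
`(p̂_τ)` be smooth positive probability densities starting at `p̂_0 = p_∞` and
satisfying the transport equation with velocity field `uHat` built from a learned score
`ŝ`. If the integrated KL identity along transport equations is valid and enough
integrability holds, then
`KL(p_0 | p̂_T) ≤ KL(p_T | p_∞) + ∫_0^T ∫ ((σ² + b²)²/(4b²)) ‖∇log p_{T−τ} − ŝ_{T−τ}‖² p_{T−τ}`. -/
theorem kl_bound_for_sgm {d : ℕ} (T : ℝ) (hT : 0 < T)
    (p phat : ℝ → Euc d → ℝ)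
    (f shat : ℝ → Euc d → Euc d)
    (σ b : ℝ → Euc d → ℝ)
    (pinf : Euc d → ℝ)
    -- smoothness
    (hp : ContDiff ℝ (⊤ : ℕ∞) (fun w : ℝ × Euc d => p w.1 w.2))
    (hphat : ContDiff ℝ (⊤ : ℕ∞) (fun w : ℝ × Euc d => phat w.1 w.2))
    (hf : ContDiff ℝ (⊤ : ℕ∞) (fun w : ℝ × Euc d => f w.1 w.2))
    (hshat : ContDiff ℝ (⊤ : ℕ∞) (fun w : ℝ × Euc d => shat w.1 w.2))
    (hσ : ContDiff ℝ (⊤ : ℕ∞) (fun w : ℝ × Euc d => σ w.1 w.2))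
    (hb : ContDiff ℝ (⊤ : ℕ∞) (fun w : ℝ × Euc d => b w.1 w.2))
    -- positivity and normalization
    (hppos : ∀ τ ∈ Set.Icc 0 T, ∀ y, 0 < p τ y)
    (hpprob : ∀ τ ∈ Set.Icc 0 T, Integrable (p τ) ∧ ∫ y, p τ y = 1)
    (hphatpos : ∀ τ ∈ Set.Icc 0 T, ∀ y, 0 < phat τ y)
    (hphatprob : ∀ τ ∈ Set.Icc 0 T, Integrable (phat τ) ∧ ∫ y, phat τ y = 1)
    (hσpos : ∀ τ ∈ Set.Icc 0 T, ∀ y, 0 < σ τ y)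
    (hbpos : ∀ τ ∈ Set.Icc 0 T, ∀ y, 0 < b τ y)
    (hinit : phat 0 = pinf)
    -- (i) transport equation for the reversed true dynamics
    (hrev : ∀ τ ∈ Set.Icc 0 T, ∀ y,
      deriv (fun s => p (T - s) y) τ
        = - ediv (fun y => p (T - τ) y • uRev f σ p T τ y) y)
    -- (ii) transport equation for the learned generative dynamics
    (hgen : ∀ τ ∈ Set.Icc 0 T, ∀ y,
      deriv (fun s => phat s y) τ
        = - ediv (fun y => phat τ y • uHat f σ b shat phat T τ y) y)
    -- (iii) the integrated KL identity along transport equations is valid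
    (hKL : (∫ y, p 0 y * Real.log (p 0 y / phat T y))
      = (∫ y, p T y * Real.log (p T y / pinf y))
        + ∫ τ in (0:ℝ)..T, ∫ y,
            ⟪uRev f σ p T τ y - uHat f σ b shat phat T τ y,
              score (p (T - τ)) y - score (phat τ) y⟫ * p (T - τ) y)
    -- sufficient integrability
    (hint1 : ∀ τ ∈ Set.Icc 0 T, Integrable (fun y =>
      ⟪uRev f σ p T τ y - uHat f σ b shat phat T τ y,
        score (p (T - τ)) y - score (phat τ) y⟫ * p (T - τ) y))
    (hint2 : ∀ τ ∈ Set.Icc 0 T, Integrable (fun y =>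
      (((σ (T - τ) y) ^ 2 + (b τ y) ^ 2) ^ 2 / (4 * (b τ y) ^ 2))
        * ‖score (p (T - τ)) y - shat (T - τ) y‖ ^ 2 * p (T - τ) y))
    (hint3 : IntervalIntegrable (fun τ => ∫ y,
      ⟪uRev f σ p T τ y - uHat f σ b shat phat T τ y,
        score (p (T - τ)) y - score (phat τ) y⟫ * p (T - τ) y) volume 0 T)
    (hint4 : IntervalIntegrable (fun τ => ∫ y,
      (((σ (T - τ) y) ^ 2 + (b τ y) ^ 2) ^ 2 / (4 * (b τ y) ^ 2))
        * ‖score (p (T - τ)) y - shat (T - τ) y‖ ^ 2 * p (T - τ) y) volume 0 T) :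
    (∫ y, p 0 y * Real.log (p 0 y / phat T y))
      ≤ (∫ y, p T y * Real.log (p T y / pinf y))
        + ∫ τ in (0:ℝ)..T, ∫ y,
            (((σ (T - τ) y) ^ 2 + (b τ y) ^ 2) ^ 2 / (4 * (b τ y) ^ 2))
              * ‖score (p (T - τ)) y - shat (T - τ) y‖ ^ 2 * p (T - τ) y := by
  rw [hKL]
  gcongr
  refine intervalIntegral.integral_mono_on hT.le hint3 hint4 fun τ hτ => ?_
  refine integral_mono (hint1 τ hτ) (hint2 τ hτ) fun y => ?_
  have hTτ : T - τ ∈ Set.Icc 0 T := ⟨sub_nonneg.2 hτ.2, sub_le_self T hτ.1⟩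
  refine mul_le_mul_of_nonneg_right ?_ (hppos (T - τ) hTτ y).le
  rw [uRev_sub_uHat,
    ← sub_sub_sub_cancel_right (score (p (T - τ)) y) (score (phat τ) y) (shat (T - τ) y)]
  exact inner_smul_add_smul_sub_le _ _ _ (pow_pos (hbpos τ hτ y) 2)
end

section
/- (Bregman conditional loss identity.) Let V be a finite-dimensional real inner-product space, Ω ⊆ V a convex set, and Φ : Ω → ℝ a differentiable strictly convex function; define the Bregman divergence D_Φ(a,b) := Φ(a) − Φ(b) − ⟨∇Φ(b), a − b⟩ for a, b ∈ Ω. Let (Ω', F, P) be a probability space, X : Ω' → S a random variable in a measurable space S, G : Ω' → Ω an integrable random vector with Φ(G) integrable, F : S → Ω a measurable function with F(X) = E[G | X] almost surely and Φ(F(X)) integrable, and F^θ : S → Ω measurable such that Φ(F^θ(X)), ∇Φ(F^θ(X)), ⟨∇Φ(F^θ(X)), G⟩ and ⟨∇Φ(F^θ(X)), F(X)⟩ are integrable. Then E[ D_Φ(F(X), F^θ(X)) ] = E[ D_Φ(G, F^θ(X)) ] + ( E[Φ(F(X))] − E[Φ(G)] ); in particular the two losses differ by a constant independent of F^θ. 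-/
open MeasureTheory
open scoped RealInnerProductSpace

/-- **Bregman conditional loss identity.**
Let `V` be a finite-dimensional real inner-product space, `Ωs ⊆ V` convex, and
`Φ : Ωs → ℝ` differentiable and strictly convex, with Bregman divergence
`D_Φ(a,b) = Φ(a) − Φ(b) − ⟨∇Φ(b), a − b⟩`. If `F(X) = E[G | X]` a.s. and all the
relevant quantities are integrable, then
`E[D_Φ(F(X), F^θ(X))] = E[D_Φ(G, F^θ(X))] + (E[Φ(F(X))] − E[Φ(G)])`;
in particular the two losses differ by a constant independent of `F^θ`. -/
theorem bregman_conditional_loss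
    {V : Type*} [NormedAddCommGroup V] [InnerProductSpace ℝ V] [FiniteDimensional ℝ V]
    [MeasurableSpace V] [BorelSpace V]
    {S : Type*} [MeasurableSpace S]
    {Ω' : Type*} [MeasurableSpace Ω'] (μ : Measure Ω') [IsProbabilityMeasure μ]
    (Ωs : Set V) (hΩs : Convex ℝ Ωs)
    (Φ : V → ℝ) (hΦdiff : DifferentiableOn ℝ Φ Ωs) (hΦconv : StrictConvexOn ℝ Ωs Φ)
    (X : Ω' → S) (hX : Measurable X)
    (G : Ω' → V) (hGmeas : Measurable G) (hGmem : ∀ ω, G ω ∈ Ωs)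
    (hGint : Integrable G μ) (hΦG : Integrable (fun ω => Φ (G ω)) μ)
    (F Fθ : S → V) (hF : Measurable F) (hFθ : Measurable Fθ)
    (hFmem : ∀ x, F x ∈ Ωs) (hFθmem : ∀ x, Fθ x ∈ Ωs)
    -- F(X) is (a version of) the conditional expectation of G given X
    (hcond : (fun ω => F (X ω)) =ᵐ[μ] μ[G | MeasurableSpace.comap X inferInstance])
    -- integrability assumptions
    (hΦF : Integrable (fun ω => Φ (F (X ω))) μ)
    (hΦFθ : Integrable (fun ω => Φ (Fθ (X ω))) μ)
    (h1 : Integrable (fun ω => ⟪gradient Φ (Fθ (X ω)), G ω⟫) μ)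
    (h2 : Integrable (fun ω => ⟪gradient Φ (Fθ (X ω)), F (X ω)⟫) μ)
    (h3 : Integrable (fun ω => ⟪gradient Φ (Fθ (X ω)), Fθ (X ω)⟫) μ) :
    ∫ ω, (Φ (F (X ω)) - Φ (Fθ (X ω))
        - ⟪gradient Φ (Fθ (X ω)), F (X ω) - Fθ (X ω)⟫) ∂μ
      = (∫ ω, (Φ (G ω) - Φ (Fθ (X ω))
          - ⟪gradient Φ (Fθ (X ω)), G ω - Fθ (X ω)⟫) ∂μ)
        + ((∫ ω, Φ (F (X ω)) ∂μ) - ∫ ω, Φ (G ω) ∂μ) := by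
  have hg : Measurable (fun v => gradient Φ v) :=
    (InnerProductSpace.toDual ℝ V).symm.continuous.measurable.comp (measurable_fderiv ℝ Φ)
  have key : ∫ ω, ⟪gradient Φ (Fθ (X ω)), G ω⟫ ∂μ =
      ∫ ω, ⟪gradient Φ (Fθ (X ω)), F (X ω)⟫ ∂μ := by
    have hpull := condExp_bilin_of_stronglyMeasurable_left (μ := μ) (innerSL ℝ)
      ((hg.comp hFθ).comp (comap_measurable X)).stronglyMeasurable h1 hGint
    rw [← integral_condExp hX.comap_le (f := fun ω => ⟪gradient Φ (Fθ (X ω)), G ω⟫)]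
    refine integral_congr_ae (hpull.trans ?_)
    filter_upwards [hcond] with ω hω
    rw [hω]
    rfl
  simp only [inner_sub_right]
  rw [integral_sub (by exact hΦF.sub hΦFθ) (by exact h2.sub h3), integral_sub hΦF hΦFθ, integral_sub h2 h3,
    integral_sub (by exact hΦG.sub hΦFθ) (by exact h1.sub h3), integral_sub hΦG hΦFθ,
    integral_sub h1 h3, key]
  ring
end

section
/- (Jump generator of the mixture path.) Let S be a measurable space, p_0 a probability measure on S, z ∈ S, and κ : [0,1] → [0,1] a differentiable non-decreasing function with κ_0 = 0 and κ_1 = 1. Define the mixture path p_t := (1−κ_t) p_0 + κ_t δ_z. Then for every bounded measurable f : S → ℝ and every t ∈ [0,1), the map t ↦ ∫_S f dp_t is differentiable with derivative d/dt ∫_S f dp_t = ∫_S (κ̇_t/(1−κ_t)) (f(z) − f(x)) p_t(dx), i.e. the mixture path solves the weak Kolmogorov forward equation for the pure-jump generator L_t f(x) := (κ̇_t/(1−κ_t)) (f(z) − f(x)) with jump intensity κ̇_t/(1−κ_t) and all jumps landing at z. -/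
open MeasureTheory

/-- The mixture probability path `p_t = (1 − κ_t) p₀ + κ_t δ_z`. -/
noncomputable def mixturePath {S : Type*} [MeasurableSpace S]
    (p0 : Measure S) (z : S) (κ : ℝ → ℝ) (t : ℝ) : Measure S :=
  ENNReal.ofReal (1 - κ t) • p0 + ENNReal.ofReal (κ t) • Measure.dirac z

/-- Along the mixture path, integrals are the corresponding convex combinations. -/
lemma integral_mixturePath {S : Type*} [MeasurableSpace S]
    {p0 : Measure S} {z : S} {κ : ℝ → ℝ} {t : ℝ} (h0 : 0 ≤ κ t) (h1 : κ t ≤ 1)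
    {g : S → ℝ} (hg : Measurable g) (hgi : Integrable g p0) :
    ∫ x, g x ∂(mixturePath p0 z κ t) = (1 - κ t) * ∫ x, g x ∂p0 + κ t * g z := by
  have hd : Integrable g (Measure.dirac z) :=
    integrable_dirac' hg.stronglyMeasurable (by simp)
  rw [mixturePath, integral_add_measure (hgi.smul_measure ENNReal.ofReal_ne_top)
    (hd.smul_measure ENNReal.ofReal_ne_top), integral_smul_measure, integral_smul_measure,
    integral_dirac' g z hg.stronglyMeasurable, ENNReal.toReal_ofReal (sub_nonneg.2 h1),
    ENNReal.toReal_ofReal h0, smul_eq_mul, smul_eq_mul]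

/-- A monotone function on `[a, b]` that reaches its terminal value at a time `t < b` has zero
derivative there. -/
lemma deriv_eq_zero_of_monotoneOn_of_eq_right {κ : ℝ → ℝ} {a b t k : ℝ}
    (hκ : MonotoneOn κ (Set.Icc a b)) (ht : t ∈ Set.Ico a b) (hb : κ t = κ b)
    (hd : HasDerivWithinAt κ k (Set.Icc a b) t) : k = 0 := by
  have hsub : Set.Icc t b ⊆ Set.Icc a b := Set.Icc_subset_Icc_left ht.1
  have hc : HasDerivWithinAt κ 0 (Set.Icc t b) t := by
    refine (hasDerivWithinAt_const t _ (κ b)).congr (fun s hs => le_antisymm ?_ ?_) hb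
    · exact hκ (hsub hs) (hsub ⟨ht.2.le, le_rfl⟩) hs.2
    · exact hb ▸ hκ ⟨ht.1, ht.2.le⟩ (hsub hs) hs.1
  exact (uniqueDiffOn_Icc ht.2 t ⟨le_rfl, ht.2.le⟩).eq_deriv _ (hd.mono hsub) hc

/-- **Jump generator of the mixture path.**
Let `p₀` be a probability measure on `S`, `z ∈ S` and `κ : [0,1] → [0,1]` differentiable,
non-decreasing with `κ_0 = 0` and `κ_1 = 1`. Then, for every bounded measurable `f` and
every `t ∈ [0,1)`, the map `t ↦ ∫ f dp_t` along the mixture path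
`p_t = (1−κ_t)p₀ + κ_t δ_z` is differentiable with derivative
`∫ (κ̇_t/(1−κ_t)) (f(z) − f(x)) p_t(dx)`, i.e. the mixture path solves the weak
Kolmogorov forward equation for the pure-jump generator with intensity `κ̇_t/(1−κ_t)`
and all jumps landing at `z`. -/
theorem mixture_path_jump_generator {S : Type*} [MeasurableSpace S]
    (p0 : Measure S) [IsProbabilityMeasure p0] (z : S)
    (κ κ' : ℝ → ℝ)
    (hκdiff : ∀ t ∈ Set.Icc (0:ℝ) 1, HasDerivWithinAt κ (κ' t) (Set.Icc 0 1) t)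
    (hκmono : MonotoneOn κ (Set.Icc 0 1))
    (hκ0 : κ 0 = 0) (hκ1 : κ 1 = 1)
    (f : S → ℝ) (hf : Measurable f) (hfb : ∃ C, ∀ x, |f x| ≤ C) :
    ∀ t ∈ Set.Ico (0:ℝ) 1,
      HasDerivWithinAt (fun t => ∫ x, f x ∂(mixturePath p0 z κ t))
        (∫ x, (κ' t / (1 - κ t)) * (f z - f x) ∂(mixturePath p0 z κ t))
        (Set.Icc 0 1) t := by
  intro t ht
  obtain ⟨C, hC⟩ := hfb
  have htI : t ∈ Set.Icc (0 : ℝ) 1 := ⟨ht.1, ht.2.le⟩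
  have hmem : ∀ s ∈ Set.Icc (0 : ℝ) 1, 0 ≤ κ s ∧ κ s ≤ 1 := fun s hs =>
    ⟨hκ0 ▸ hκmono ⟨le_rfl, zero_le_one⟩ hs hs.1, hκ1 ▸ hκmono hs ⟨zero_le_one, le_rfl⟩ hs.2⟩
  have hfi : Integrable f p0 :=
    Integrable.of_bound hf.aestronglyMeasurable C (Filter.Eventually.of_forall hC)
  have hpath : ∀ s ∈ Set.Icc (0 : ℝ) 1, ∫ x, f x ∂(mixturePath p0 z κ s)
      = (1 - κ s) * ∫ x, f x ∂p0 + κ s * f z := fun s hs =>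
    integral_mixturePath (hmem s hs).1 (hmem s hs).2 hf hfi
  have hd := hκdiff t htI
  have hrhs : ∫ x, (κ' t / (1 - κ t)) * (f z - f x) ∂(mixturePath p0 z κ t)
      = -κ' t * ∫ x, f x ∂p0 + κ' t * f z := by
    rw [integral_const_mul, integral_mixturePath (g := fun x => f z - f x)
      (hmem t htI).1 (hmem t htI).2
      (measurable_const.sub hf) ((integrable_const _).sub hfi),
      integral_sub (integrable_const _) hfi]
    rcases eq_or_ne (κ t) 1 with h | h
    · rw [deriv_eq_zero_of_monotoneOn_of_eq_right hκmono ht (h.trans hκ1.symm) hd]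
      simp
    · have : 1 - κ t ≠ 0 := sub_ne_zero.2 h.symm
      simp only [integral_const, probReal_univ, one_smul, sub_self]
      field_simp
      ring
  rw [hrhs]
  exact (((hd.const_sub 1).mul_const _).add (hd.mul_const _)).congr hpath (hpath t htI)
end

section
/- (Posterior covariance formula for the drift Jacobian.) Let p⋆ be a probability density on ℝ^d, m, ṁ : ℝ^d → ℝ^d measurable, σ > 0, η ∈ ℝ, and let φ_σ denote the density of N(0, σ² Id). Define p(x) := ∫ p⋆(z) φ_σ(x − m(z)) dz, assume p(x) > 0 for all x, define the posterior density π_x(z) := p⋆(z) φ_σ(x − m(z)) / p(x), and define the drift a(x) := ∫ ( ṁ(z) + η (x − m(z)) ) π_x(z) dz. Under sufficient integrability so that differentiation under the integral sign is valid, a is differentiable and its Jacobian satisfies, for all x, ∇a(x) = η Id − (η/σ²) Cov_{π_x}(m(Z)) + (1/σ²) Cov_{π_x}(ṁ(Z), m(Z)), where Cov_{π_x}(m(Z)) := ∫ (m(z) − M(x))(m(z) − M(x))^⊤ π_x(z)dz with M(x) := ∫ m dπ_x, and Cov_{π_x}(ṁ(Z), m(Z)) := ∫ (ṁ(z) − Ṁ(x))(m(z)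 − M(x))^⊤ π_x(z)dz with Ṁ(x) := ∫ ṁ dπ_x. -/
open MeasureTheory
open scoped RealInnerProductSpace

/-- Density of `N(0, σ² Id)` on `ℝ^d`: `φ_σ(y) = (2πσ²)^{−d/2} exp(−‖y‖²/(2σ²))`. -/
noncomputable def gaussDensity (d : ℕ) (σ : ℝ) (y : Euc d) : ℝ :=
  (2 * Real.pi * σ ^ 2) ^ (-(d : ℝ) / 2) * Real.exp (-‖y‖ ^ 2 / (2 * σ ^ 2))

/-- Unnormalized posterior kernel `p⋆(z) φ_σ(x − m(z))`. -/
noncomputable def postKer {d : ℕ} (pstar : Euc d → ℝ) (m : Euc d → Euc d) (σ : ℝ)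
    (x z : Euc d) : ℝ :=
  pstar z * gaussDensity d σ (x - m z)

/-- Marginal density `p(x) = ∫ p⋆(z) φ_σ(x − m(z)) dz`. -/
noncomputable def marg {d : ℕ} (pstar : Euc d → ℝ) (m : Euc d → Euc d) (σ : ℝ)
    (x : Euc d) : ℝ :=
  ∫ z, postKer pstar m σ x z

/-- Posterior density `π_x(z) = p⋆(z) φ_σ(x − m(z)) / p(x)`. -/
noncomputable def post {d : ℕ} (pstar : Euc d → ℝ) (m : Euc d → Euc d) (σ : ℝ)
    (x z : Euc d) : ℝ :=
  postKer pstar m σ x z / marg pstar m σ x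

/-- Posterior expectation `∫ f(z) π_x(z) dz`. -/
noncomputable def postMean {d : ℕ} (pstar : Euc d → ℝ) (m : Euc d → Euc d) (σ : ℝ)
    (f : Euc d → Euc d) (x : Euc d) : Euc d :=
  ∫ z, post pstar m σ x z • f z

/-- The exact drift `a(x) = ∫ (ṁ(z) + η(x − m(z))) π_x(z) dz`. -/
noncomputable def gaussDrift {d : ℕ} (pstar : Euc d → ℝ) (m mdot : Euc d → Euc d)
    (σ η : ℝ) (x : Euc d) : Euc d :=
  ∫ z, post pstar m σ x z • (mdot z + η • (x - m z))

theorem integrable_inner_mul {α E : Type*} [MeasurableSpace α] {μ : Measure α}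
    [NormedAddCommGroup E] [InnerProductSpace ℝ E] {q : α → ℝ} {g : α → E}
    (hg : Integrable (fun z => q z • g z) μ) (v : E) :
    Integrable (fun z => ⟪g z, v⟫ * q z) μ := by
  simpa [real_inner_smul_left, mul_comm] using hg.inner_const (𝕜 := ℝ) v

theorem integral_inner_mul {α E : Type*} [MeasurableSpace α] {μ : Measure α}
    [NormedAddCommGroup E] [InnerProductSpace ℝ E] [CompleteSpace E] {q : α → ℝ} {g : α → E}
    (hg : Integrable (fun z => q z • g z) μ) (v : E) :
    ∫ z, ⟪g z, v⟫ * q z ∂μ = ⟪∫ z, q z • g z ∂μ, v⟫ := by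
  rw [real_inner_comm, ← integral_inner hg v]
  refine integral_congr_ae (.of_forall fun z => ?_)
  simp [real_inner_smul_right, real_inner_comm, mul_comm]

/-- Expansion of a weighted, shifted cross-moment into unshifted moments. -/
theorem integral_inner_sub_mul_smul_sub {α E F : Type*} [MeasurableSpace α] {μ : Measure α}
    [NormedAddCommGroup E] [InnerProductSpace ℝ E] [CompleteSpace E]
    [NormedAddCommGroup F] [NormedSpace ℝ F] [CompleteSpace F]
    {q : α → ℝ} {g : α → E} {f : α → F} (hq : Integrable q μ) (hq1 : ∫ z, q z ∂μ = 1)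
    (hg : Integrable (fun z => q z • g z) μ) (hf : Integrable (fun z => q z • f z) μ) (v : E)
    (hgf : Integrable (fun z => (⟪g z, v⟫ * q z) • f z) μ) (c : E) (e : F) :
    ∫ z, (⟪g z - c, v⟫ * q z) • (f z - e) ∂μ
      = ∫ z, (⟪g z, v⟫ * q z) • f z ∂μ - ⟪c, v⟫ • ∫ z, q z • f z ∂μ
        - (⟪∫ z, q z • g z ∂μ, v⟫ - ⟪c, v⟫) • e := by
  have hgv := integrable_inner_mul hg v
  have hexp : ∀ z, (⟪g z - c, v⟫ * q z) • (f z - e)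
      = ((⟪g z, v⟫ * q z) • f z - ⟪c, v⟫ • (q z • f z))
        - (⟪g z, v⟫ * q z - ⟪c, v⟫ * q z) • e := fun z => by
    rw [inner_sub_left]
    module
  simp_rw [hexp]
  rw [integral_sub (hgf.sub' (hf.fun_smul _)) ((hgv.sub' (hq.const_mul _)).smul_const e),
    integral_sub hgf (hf.fun_smul _), integral_smul, integral_smul_const,
    integral_sub hgv (hq.const_mul _), integral_const_mul, hq1, integral_inner_mul hg v, mul_one]

/-- **Posterior covariance formula for the drift Jacobian.**
The drift `a(x) = ∫ (ṁ(z) + η(x − m(z))) π_x(z) dz` of a Gaussian-interpolation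
generative SDE is differentiable and its Jacobian satisfies
`∇a(x) = η Id − (η/σ²) Cov_{π_x}(m(Z)) + (1/σ²) Cov_{π_x}(ṁ(Z), m(Z))`,
where the covariance matrices act on `v` by
`Cov_{π_x}(m) v = ∫ ⟨m(z) − M(x), v⟩ (m(z) − M(x)) dπ_x` and
`Cov_{π_x}(ṁ, m) v = ∫ ⟨m(z) − M(x), v⟩ (ṁ(z) − Ṁ(x)) dπ_x`. -/
theorem posterior_covariance_drift_jacobian {d : ℕ}
    (pstar : Euc d → ℝ) (m mdot : Euc d → Euc d) (σ η : ℝ) (hσ : 0 < σ)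
    (hpmeas : Measurable pstar) (hpnn : ∀ z, 0 ≤ pstar z)
    (hpint : Integrable pstar) (hpprob : ∫ z, pstar z = 1)
    (hm : Measurable m) (hmdot : Measurable mdot)
    (hpos : ∀ x, 0 < marg pstar m σ x)
    -- sufficient integrability
    (hintK : ∀ x, Integrable (fun z => postKer pstar m σ x z))
    (hintm : ∀ x, Integrable (fun z => postKer pstar m σ x z • m z))
    (hintmdot : ∀ x, Integrable (fun z => postKer pstar m σ x z • mdot z))
    (hintcross : ∀ (x v : Euc d),
      Integrable (fun z => (⟪m z, v⟫ * postKer pstar m σ x z) • m z)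
      ∧ Integrable (fun z => (⟪m z, v⟫ * postKer pstar m σ x z) • mdot z))
    -- differentiation under the integral sign is valid
    (hswapN : ∀ x, ∃ L : Euc d →L[ℝ] Euc d,
      HasFDerivAt (fun x => ∫ z, postKer pstar m σ x z • (mdot z + η • (x - m z))) L x ∧
      ∀ v, L v = ∫ z,
        (((σ ^ 2)⁻¹ * ⟪m z - x, v⟫ * postKer pstar m σ x z) • (mdot z + η • (x - m z))
          + (η * postKer pstar m σ x z) • v))
    (hswapD : ∀ x, ∃ ℓ : Euc d →L[ℝ] ℝ,
      HasFDerivAt (marg pstar m σ) ℓ x ∧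
      ∀ v, ℓ v = ∫ z, (σ ^ 2)⁻¹ * ⟪m z - x, v⟫ * postKer pstar m σ x z) :
    ∀ x : Euc d,
      DifferentiableAt ℝ (gaussDrift pstar m mdot σ η) x
      ∧ ∀ v, fderiv ℝ (gaussDrift pstar m mdot σ η) x v
          = η • v
            - (η / σ ^ 2) •
                (∫ z, (⟪m z - postMean pstar m σ m x, v⟫ * post pstar m σ x z)
                  • (m z - postMean pstar m σ m x))
            + (σ ^ 2)⁻¹ •
                (∫ z, (⟪m z - postMean pstar m σ m x, v⟫ * post pstar m σ x z)
                  • (mdot z - postMean pstar m σ mdot x)) := by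
  intro x
  have hp := (hpos x).ne'
  have hpost : ∀ y z, post pstar m σ y z = (marg pstar m σ y)⁻¹ * postKer pstar m σ y z :=
    fun y z => div_eq_inv_mul _ _
  have hdrift : gaussDrift pstar m mdot σ η = fun y =>
      (marg pstar m σ y)⁻¹ • ∫ z, postKer pstar m σ y z • (mdot z + η • (y - m z)) := by
    funext y
    simp_rw [gaussDrift, hpost, mul_smul, integral_smul]
  obtain ⟨L, hL, hLv⟩ := hswapN x
  obtain ⟨l, hl, hlv⟩ := hswapD x
  have hD : HasFDerivAt (gaussDrift pstar m mdot σ η)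
      ((marg pstar m σ x)⁻¹ • L + (-(marg pstar m σ x ^ 2)⁻¹ • l).smulRight
        (∫ z, postKer pstar m σ x z • (mdot z + η • (x - m z)))) x := by
    rw [hdrift]
    exact ((hasDerivAt_inv hp).comp_hasFDerivAt x hl).smul hL
  refine ⟨hD.differentiableAt, fun v => ?_⟩
  have hq : Integrable (fun z => post pstar m σ x z) := by
    simp_rw [hpost]
    exact (hintK x).const_mul _
  have hq1 : ∫ z, post pstar m σ x z = 1 := by
    simp_rw [hpost, integral_const_mul]
    exact inv_mul_cancel₀ hp
  have hqf : ∀ f : Euc d → Euc d, Integrable (fun z => postKer pstar m σ x z • f z) →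
      Integrable (fun z => post pstar m σ x z • f z) := fun f hf => by
    simp_rw [hpost, mul_smul]
    exact hf.fun_smul _
  have hqm := hqf _ (hintm x)
  have hqmdot := hqf _ (hintmdot x)
  have hcross : ∀ f : Euc d → Euc d,
      Integrable (fun z => (⟪m z, v⟫ * postKer pstar m σ x z) • f z) →
      Integrable (fun z => (⟪m z, v⟫ * post pstar m σ x z) • f z) := fun f hf => by
    simp_rw [hpost, mul_left_comm _ (marg pstar m σ x)⁻¹, mul_smul _ (_ * _)]
    exact hf.fun_smul _
  have hmm := hcross _ (hintcross x v).1
  have hmmdot := hcross _ (hintcross x v).2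
  have hmv := integrable_inner_mul hqm v
  have hmx : Integrable (fun z => (⟪m z, v⟫ * post pstar m σ x z) • x) := hmv.smul_const x
  have hmx_eq : ∫ z, (⟪m z, v⟫ * post pstar m σ x z) • x
      = ⟪postMean pstar m σ m x, v⟫ • x := by
    rw [integral_smul_const, integral_inner_mul hqm v]
    rfl
  have hb_exp : ∀ z, post pstar m σ x z • (mdot z + η • (x - m z))
      = post pstar m σ x z • mdot z
        + η • (post pstar m σ x z • x - post pstar m σ x z • m z) := fun z => by module
  have hb : Integrable (fun z => post pstar m σ x z • (mdot z + η • (x - m z))) := by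
    simp_rw [hb_exp]
    exact hqmdot.fun_add (((hq.smul_const x).sub' hqm).fun_smul η)
  have hb_eq : gaussDrift pstar m mdot σ η x
      = postMean pstar m σ mdot x + η • (x - postMean pstar m σ m x) := by
    simp_rw [gaussDrift, hb_exp]
    rw [integral_add hqmdot (((hq.smul_const x).sub' hqm).fun_smul η), integral_smul,
      integral_sub (hq.smul_const x) hqm, integral_smul_const, hq1, one_smul]
    rfl
  have hmb_exp : ∀ z, (⟪m z, v⟫ * post pstar m σ x z) • (mdot z + η • (x - m z))
      = (⟪m z, v⟫ * post pstar m σ x z) • mdot z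
        + η • ((⟪m z, v⟫ * post pstar m σ x z) • x - (⟪m z, v⟫ * post pstar m σ x z) • m z) :=
    fun z => by module
  have hmb : Integrable
      (fun z => (⟪m z, v⟫ * post pstar m σ x z) • (mdot z + η • (x - m z))) := by
    simp_rw [hmb_exp]
    exact hmmdot.fun_add ((hmx.sub' hmm).fun_smul η)
  have hmb_eq : ∫ z, (⟪m z, v⟫ * post pstar m σ x z) • (mdot z + η • (x - m z))
      = (∫ z, (⟪m z, v⟫ * post pstar m σ x z) • mdot z)
        + η • (⟪postMean pstar m σ m x, v⟫ • x
          - ∫ z, (⟪m z, v⟫ * post pstar m σ x z) • m z) := by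
    simp_rw [hmb_exp]
    rw [integral_add hmmdot ((hmx.sub' hmm).fun_smul η), integral_smul, integral_sub hmx hmm, hmx_eq]
  have hshift_exp : ∀ z, (⟪m z - x, v⟫ * post pstar m σ x z) • (mdot z + η • (x - m z))
      = (⟪m z, v⟫ * post pstar m σ x z) • (mdot z + η • (x - m z))
        - ⟪x, v⟫ • (post pstar m σ x z • (mdot z + η • (x - m z))) := fun z => by
    rw [inner_sub_left]
    module
  have hshift : Integrable
      (fun z => (⟪m z - x, v⟫ * post pstar m σ x z) • (mdot z + η • (x - m z))) := by
    simp_rw [hshift_exp]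
    exact hmb.sub' (hb.fun_smul _)
  have hN : (marg pstar m σ x)⁻¹ • L v
      = (σ ^ 2)⁻¹ • ((∫ z, (⟪m z, v⟫ * post pstar m σ x z) • (mdot z + η • (x - m z)))
        - ⟪x, v⟫ • gaussDrift pstar m mdot σ η x) + η • v := by
    have hexp : ∀ z, (marg pstar m σ x)⁻¹ •
        (((σ ^ 2)⁻¹ * ⟪m z - x, v⟫ * postKer pstar m σ x z) • (mdot z + η • (x - m z))
          + (η * postKer pstar m σ x z) • v)
        = (σ ^ 2)⁻¹ • ((⟪m z - x, v⟫ * post pstar m σ x z) • (mdot z + η • (x - m z)))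
          + η • (post pstar m σ x z • v) := fun z => by
      rw [hpost]
      module
    rw [hLv, ← integral_smul]
    simp_rw [hexp]
    rw [integral_add (hshift.fun_smul _) ((hq.smul_const v).fun_smul η), integral_smul, integral_smul,
      integral_smul_const, hq1, one_smul]
    simp_rw [hshift_exp]
    rw [integral_sub hmb (hb.fun_smul _), integral_smul]
    rfl
  have hd : (marg pstar m σ x)⁻¹ * l v
      = (σ ^ 2)⁻¹ * (⟪postMean pstar m σ m x, v⟫ - ⟪x, v⟫) := by
    have hexp : ∀ z, (marg pstar m σ x)⁻¹ *
        ((σ ^ 2)⁻¹ * ⟪m z - x, v⟫ * postKer pstar m σ x z)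
        = (σ ^ 2)⁻¹ * (⟪m z, v⟫ * post pstar m σ x z - ⟪x, v⟫ * post pstar m σ x z) :=
      fun z => by
        rw [hpost, inner_sub_left]
        ring
    rw [hlv, ← integral_const_mul]
    simp_rw [hexp]
    rw [integral_const_mul, integral_sub hmv (hq.const_mul _), integral_inner_mul hqm v,
      integral_const_mul, hq1, mul_one]
    rfl
  have hJ : fderiv ℝ (gaussDrift pstar m mdot σ η) x v
      = (marg pstar m σ x)⁻¹ • L v
        - ((marg pstar m σ x)⁻¹ * l v) • gaussDrift pstar m mdot σ η x := by
    rw [hD.fderiv, congrFun hdrift x]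
    simp only [add_apply, smul_apply,
      ContinuousLinearMap.smulRight_apply, smul_eq_mul]
    module
  rw [hJ, hN, hd, hmb_eq, hb_eq,
    integral_inner_sub_mul_smul_sub hq hq1 hqm hqm v hmm,
    integral_inner_sub_mul_smul_sub hq hq1 hqm hqmdot v hmmdot]
  simp only [← postMean.eq_def]
  module
end
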